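/- Let G be a connected graph with N vertices and let M be a positive integer with 2M ≤ N, such that for every pair of disjoint vertex sets S and T with |S| = |T| = M there is an edge of G joining S and T. Then for every vertex v ∈ V(G), there is a path in G of length N − 2M (i.e., with N − 2M edges) having v as one of its endpoints. -/

import Mathlib

open Classical in
/-- A depth-first search from `v` in a connected graph: at some moment the set `D` of finished
vertices is as large as the set of vertices not yet visited. The current search path `P` is
stored with `v` as its last vertex. -/
theorem SimpleGraph.Connected.exists_isPath_balanced_separation {V : Type*} [Fintype V]
    {G : SimpleGraph V} (hconn : G.Connected) {v : V} (k : ℕ) :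
    ∀ (u : V) (P : G.Walk u v) (D : Finset V), P.IsPath →
      Disjoint D P.support.toFinset →
      (∀ x ∈ D, ∀ y, G.Adj x y → y ∈ D ∨ y ∈ P.support) →
      (D ∪ P.support.toFinset)ᶜ.card = D.card + k →
      ∃ (u : V) (P : G.Walk u v) (D : Finset V), P.IsPath ∧
        Disjoint D P.support.toFinset ∧
        (∀ x ∈ D, ∀ y, G.Adj x y → y ∈ D ∨ y ∈ P.support) ∧
        (D ∪ P.support.toFinset)ᶜ.card = D.card := by
  induction k with
  | zero => exact fun u P D hP hD hsep hcard => ⟨u, P, D, hP, hD, hsep, hcard⟩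
  | succ k ih =>
    intro u P D hP hD hsep hcard
    by_cases hext : ∃ w, G.Adj u w ∧ w ∉ D ∧ w ∉ P.support
    · obtain ⟨w, huw, hwD, hwP⟩ := hext
      refine ih w (.cons huw.symm P) D (hP.cons hwP) ?_ ?_ ?_
      · simp [hwD, hD]
      · intro x hx y hxy
        rcases hsep x hx y hxy with h | h <;> simp [h]
      · have hset : (D ∪ (SimpleGraph.Walk.cons huw.symm P).support.toFinset)ᶜ
            = (D ∪ P.support.toFinset)ᶜ.erase w := by
          ext x
          simp
        rw [hset, Finset.card_erase_of_mem (by simp [hwD, hwP]), hcard]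
        omega
    · push Not at hext
      cases P with
      | nil =>
        exfalso
        have hne : (D ∪ (SimpleGraph.Walk.nil : G.Walk v v).support.toFinset)ᶜ.Nonempty := by
          rw [← Finset.card_pos]
          omega
        obtain ⟨w, hw⟩ := hne
        obtain ⟨p⟩ := hconn.preconnected v w
        obtain ⟨d, -, hd₁, hd₂⟩ := p.exists_boundary_dart {x | x ∈ D ∨ x = v} (by simp)
          (by simpa [and_comm] using hw)
        have hadj := d.adj
        rcases hd₁ with h | h
        · exact hd₂ (by simpa using hsep _ h _ hadj)
        · rw [h] at hadj
          refine hd₂ (or_iff_not_imp_left.mpr fun hn => ?_)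
          simpa using hext _ hadj hn
      | @cons _ u' _ huu' Q =>
        rw [SimpleGraph.Walk.cons_isPath_iff] at hP
        have huD : u ∉ D := by
          intro h
          exact Finset.disjoint_left.mp hD h (by simp)
        have hset : insert u D ∪ Q.support.toFinset
            = D ∪ (SimpleGraph.Walk.cons huu' Q).support.toFinset := by
          ext x
          simp
        refine ih u' Q (insert u D) hP.1 ?_ ?_ ?_
        · rw [Finset.disjoint_insert_left]
          refine ⟨by simpa using hP.2, hD.mono_right ?_⟩
          intro x hx
          simp_all
        · intro x hx y hxy
          have hmem : y ∈ D ∨ y ∈ (SimpleGraph.Walk.cons huu' Q).support := by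
            rcases Finset.mem_insert.mp hx with rfl | hx
            · exact or_iff_not_imp_left.mpr (hext y hxy)
            · exact hsep x hx y hxy
          simp only [SimpleGraph.Walk.support_cons, List.mem_cons] at hmem
          simp only [Finset.mem_insert]
          tauto
        · rw [hset, hcard, Finset.card_insert_of_notMem huD]
          omega


/-- **Lemma 6 (Ben-Eliezer–Krivelevich–Sudakov).** If `G` is a connected graph on `N`
vertices such that every two disjoint vertex sets of size `M` are joined by an edge, then
every vertex is an endpoint of a path of length `N - 2M`. -/
theorem statement_14 {V : Type*} [Fintype V] (G : SimpleGraph V) (hconn : G.Connected)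
    (M : ℕ) (hM : 0 < M) (h2M : 2 * M ≤ Fintype.card V)
    (hexp : ∀ S T : Finset V, Disjoint S T → S.card = M → T.card = M →
      ∃ u ∈ S, ∃ v ∈ T, G.Adj u v)
    (v : V) :
    ∃ (u : V) (P : G.Walk v u), P.IsPath ∧ P.length = Fintype.card V - 2 * M := by
  classical
  have hstart : (∅ ∪ (SimpleGraph.Walk.nil : G.Walk v v).support.toFinset)ᶜ.card
      = (∅ : Finset V).card + (Fintype.card V - 1) := by
    simp [Finset.card_compl]
  obtain ⟨u, P, D, hP, hD, hsep, hcard⟩ :=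
    hconn.exists_isPath_balanced_separation _ v .nil ∅ .nil (by simp) (by simp) hstart
  have hlt : D.card < M := by
    by_contra! hle
    obtain ⟨S, hS, hSM⟩ := Finset.exists_subset_card_eq hle
    obtain ⟨T, hT, hTM⟩ := Finset.exists_subset_card_eq (hle.trans hcard.ge)
    have hTD : ∀ x ∈ T, x ∉ D ∧ x ∉ P.support := fun x hx => by simpa using hT hx
    obtain ⟨x, hx, y, hy, hxy⟩ := hexp S T
      (Finset.disjoint_left.mpr fun x hx hx' => (hTD x hx').1 (hS hx)) hSM hTM
    rcases hsep x (hS hx) y hxy with h | h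
    · exact (hTD y hy).1 h
    · exact (hTD y hy).2 h
  have hlen : Fintype.card V - 2 * M ≤ P.length := by
    have hsupp : P.support.toFinset.card = P.length + 1 := by
      rw [List.toFinset_card_of_nodup hP.support_nodup, P.length_support]
    rw [Finset.card_compl, Finset.card_union_of_disjoint hD, hsupp] at hcard
    omega
  refine ⟨_, P.reverse.take (Fintype.card V - 2 * M), hP.reverse.take _, ?_⟩
  rw [SimpleGraph.Walk.take_length, P.length_reverse]
  exact min_eq_left hlen
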